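/- Under the standing assumptions, for every δ > 0 there is a constant C(δ) such that for all distinct z₁, z₂, z₃, z₄ ∈ (1−δ)𝔹 the four-point function satisfies |k₄(z₁, z₂, z₃, z₄)|⁴ ≤ C(δ) ∏_{i=1}^4 (1 + max_{j ≠ i} s(|zᵢ − zⱼ|)²). -/

import Mathlib

open MeasureTheory ProbabilityTheory Metric Filter Topology Set

noncomputable section

abbrev Euc (d : ℕ) : Type := EuclideanSpace ℝ (Fin d)

/-- The scaling function `s`: `s(r) = -log r` if `d = 2`, and `s(r) = r^(2-d)` if `d ≥ 3`. -/
noncomputable def sFun (d : ℕ) (r : ℝ) : ℝ :=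
  if d = 2 then -Real.log r else r ^ ((2 : ℝ) - (d : ℝ))

open Classical in
/-- The zero boundary Green's function of the open unit ball in `ℝ^d`:
`G(x,y) = s(|x-y|) - s(|x|·|y - x/|x|²|)`, interpreted by continuity at `x = 0`. -/
noncomputable def greenBall (d : ℕ) (x y : Euc d) : ℝ :=
  if x = 0 then sFun d ‖y‖ - sFun d 1
  else sFun d ‖x - y‖ - sFun d (‖x‖ * ‖y - (‖x‖ ^ 2)⁻¹ • x‖)

/-- Smooth compactly supported test functions. -/
def IsTestFun {d : ℕ} (f : Euc d → ℝ) : Prop :=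
  ContDiff ℝ (⊤ : ℕ∞) f ∧ HasCompactSupport f

/-- The Laplacian of `u : ℝ^d → ℝ` at `x`, as the sum of pure second derivatives in the
coordinate directions. -/
noncomputable def lap {d : ℕ} (u : Euc d → ℝ) (x : Euc d) : ℝ :=
  ∑ i : Fin d, iteratedFDeriv ℝ 2 u x ![EuclideanSpace.single i 1, EuclideanSpace.single i 1]

/-- A function is harmonic on a set if it is twice continuously differentiable there with
vanishing Laplacian. -/
def IsHarmonicOn {d : ℕ} (u : Euc d → ℝ) (s : Set (Euc d)) : Prop :=
  ContDiffOn ℝ 2 u s ∧ ∀ x ∈ s, lap u x = 0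

/-- A real random variable is a (possibly degenerate) centered Gaussian. -/
def IsCenteredGaussianRV {Ω : Type} [MeasurableSpace Ω] (P : Measure Ω) (Y : Ω → ℝ) : Prop :=
  ∃ v : NNReal, Measure.map Y P = ProbabilityTheory.gaussianReal 0 v

/-- The standing assumptions: a collection of stochastic processes `h a r` (thought of as
`h^{a + r𝔹}`) indexed by test functions, which is centered, a.s. linear, zero outside the ball,
translation/scaling covariant, satisfies the domain Markov property (with the decomposition
recorded as data `H`, `Φ`, `φharm`), has fourth moments, a (sequentially) continuous covariance
bilinear form on `C_c^∞(𝔹)`, and zero boundary conditions. -/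
structure GFF (d : ℕ) (Ω : Type) [MeasurableSpace Ω] where
  P : Measure Ω
  prob : IsProbabilityMeasure P
  /-- the field `h^{a+r𝔹}` tested against `f` -/
  h : Euc d → ℝ → (Euc d → ℝ) → Ω → ℝ
  meas_h : ∀ a r f, Measurable (h a r f)
  integrable_h : ∀ a r f, IsTestFun f → Integrable (h a r f) P
  /-- centered -/
  centered : ∀ a r f, IsTestFun f → ∫ ω, h a r f ω ∂P = 0
  /-- (1) a.s. linearity in the test function -/
  lin_add : ∀ f g : Euc d → ℝ, IsTestFun f → IsTestFun g →
    ∀ᵐ ω ∂P, h 0 1 (f + g) ω = h 0 1 f ω + h 0 1 g ω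
  lin_smul : ∀ (c : ℝ) (f : Euc d → ℝ), IsTestFun f →
    ∀ᵐ ω ∂P, h 0 1 (c • f) ω = c * h 0 1 f ω
  /-- (2) the field vanishes on test functions supported outside the ball -/
  zero_outside : ∀ f : Euc d → ℝ, IsTestFun f → tsupport f ⊆ (ball (0 : Euc d) 1)ᶜ →
    ∀ᵐ ω ∂P, h 0 1 f ω = 0
  /-- (3) translation and scaling: `(h^{a+r𝔹}, f((·-a)/r)) = r^{1+d/2} (h^𝔹, f)` in law,
  as processes (equality of finite dimensional distributions) -/
  scaling : ∀ (a : Euc d) (r : ℝ), 0 < r → ∀ (k : ℕ) (f : Fin k → Euc d → ℝ),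
    (∀ i, IsTestFun (f i)) →
    Measure.map (fun ω (i : Fin k) => h a r (fun x => f i (r⁻¹ • (x - a))) ω) P
      = Measure.map (fun ω (i : Fin k) => r ^ (1 + (d : ℝ) / 2) * h 0 1 (f i) ω) P
  /-- (4) domain Markov property: the decomposition data. `H a r` is the independent copy of
  `h^{a+r𝔹}`, `Φ a r` is the harmonic part as a process, `φharm a r ω` is the harmonic function. -/
  H : Euc d → ℝ → (Euc d → ℝ) → Ω → ℝ
  Φ : Euc d → ℝ → (Euc d → ℝ) → Ω → ℝ
  φharm : Euc d → ℝ → Ω → Euc d → ℝ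
  meas_H : ∀ a r f, Measurable (H a r f)
  meas_Φ : ∀ a r f, Measurable (Φ a r f)
  meas_φharm : ∀ a r z, Measurable fun ω => φharm a r ω z
  dmp_decomp : ∀ (a : Euc d) (r : ℝ), 0 < r → ball a r ⊆ ball (0 : Euc d) 1 →
    ∀ f : Euc d → ℝ, IsTestFun f → ∀ᵐ ω ∂P, h 0 1 f ω = H a r f ω + Φ a r f ω
  dmp_indep : ∀ (a : Euc d) (r : ℝ), 0 < r → ball a r ⊆ ball (0 : Euc d) 1 →
    ProbabilityTheory.Indep
      (⨆ f : {f : Euc d → ℝ // IsTestFun f}, MeasurableSpace.comap (H a r f.1) inferInstance)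
      ((⨆ f : {f : Euc d → ℝ // IsTestFun f}, MeasurableSpace.comap (Φ a r f.1) inferInstance) ⊔
        (⨆ z : Euc d, MeasurableSpace.comap (fun ω => φharm a r ω z) inferInstance)) P
  dmp_law : ∀ (a : Euc d) (r : ℝ), 0 < r → ball a r ⊆ ball (0 : Euc d) 1 →
    ∀ (k : ℕ) (f : Fin k → Euc d → ℝ), (∀ i, IsTestFun (f i)) →
    Measure.map (fun ω (i : Fin k) => H a r (f i) ω) P
      = Measure.map (fun ω (i : Fin k) => h a r (f i) ω) P
  dmp_harm : ∀ (a : Euc d) (r : ℝ), 0 < r → ball a r ⊆ ball (0 : Euc d) 1 →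
    ∀ᵐ ω ∂P, IsHarmonicOn (φharm a r ω) (ball a r) ∧
      ∀ f : Euc d → ℝ, IsTestFun f → tsupport f ⊆ ball a r →
        Φ a r f ω = ∫ x in ball a r, φharm a r ω x * f x
  /-- (5) fourth moments -/
  mom4 : ∀ f : Euc d → ℝ, IsTestFun f → Integrable (fun ω => (h 0 1 f ω) ^ 4) P
  /-- (6) sequential continuity of the covariance bilinear form on `C_c^∞(𝔹)` -/
  K2_cont : ∀ (f : ℕ → Euc d → ℝ) (f₀ g : Euc d → ℝ) (K : Set (Euc d)),
    IsCompact K → K ⊆ ball (0 : Euc d) 1 →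
    (∀ n, IsTestFun (f n)) → IsTestFun f₀ → IsTestFun g → tsupport g ⊆ ball (0 : Euc d) 1 →
    (∀ n, tsupport (f n) ⊆ K) → tsupport f₀ ⊆ K →
    (∀ m : ℕ, TendstoUniformly (fun n => iteratedFDeriv ℝ m (f n)) (iteratedFDeriv ℝ m f₀) atTop) →
    Tendsto (fun n => ∫ ω, h 0 1 (f n) ω * h 0 1 g ω ∂P) atTop
      (𝓝 (∫ ω, h 0 1 f₀ ω * h 0 1 g ω ∂P))
  /-- (7) zero boundary conditions -/
  zero_bdry : ∀ f : ℕ → Euc d → ℝ,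
    (∀ n, IsTestFun (f n)) → (∀ n x, 0 ≤ f n x) →
    (∃ C : ℝ, ∀ n, ∫ x, f n x ≤ C) →
    Tendsto (fun n => Metric.infDist (0 : Euc d) (tsupport (f n))) atTop (𝓝 1) →
    (∃ C : ℝ, ∀ (n : ℕ) (x y : Euc d), ‖x‖ = ‖y‖ → ‖x‖ < 1 → f n x ≤ C * f n y) →
    Tendsto (fun n => ∫ ω, (h 0 1 (f n) ω) ^ 2 ∂P) atTop (𝓝 0)

instance {d : ℕ} {Ω : Type} [MeasurableSpace Ω] (X : GFF d Ω) : IsProbabilityMeasure X.P :=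
  X.prob

/-- A valid choice of radii in the definition of the four-point function. -/
noncomputable def k4eps {d : ℕ} (z : Fin 4 → Euc d) (i : Fin 4) : ℝ :=
  min ((⨅ j : {j : Fin 4 // j ≠ i}, dist (z i) (z j.1)) / 2) (1 - ‖z i‖) / 2

/-- The four-point function `k₄(z₁,...,z₄) = E[∏ᵢ φ^{zᵢ+aᵢ𝔹}_𝔹(zᵢ)]`
(independent of the admissible choices of `aᵢ`, under the standing assumptions). -/
noncomputable def GFF.k4 {d : ℕ} {Ω : Type} [MeasurableSpace Ω] (X : GFF d Ω) (z : Fin 4 → Euc d) : ℝ :=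
  ∫ ω, ∏ i, X.φharm (z i) (k4eps z i) ω (z i) ∂X.P


lemma hasDerivAt_integral_comp_smul_mul {d : ℕ} {u η : Euc d → ℝ} (hu : ContDiff ℝ 1 u)
    (huc : HasCompactSupport u) (hη : Continuous η) (hηc : HasCompactSupport η) (z : Euc d)
    (t : ℝ) :
    HasDerivAt (fun t : ℝ => ∫ x, u (z + t • x) * η x)
      (∫ x, fderiv ℝ u (z + t • x) x * η x) t := by
  have hfc : Continuous (fderiv ℝ u) := hu.continuous_fderiv (by norm_num)
  obtain ⟨M, hM⟩ := (huc.fderiv (𝕜 := ℝ)).exists_bound_of_continuous hfc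
  have hcomp : ∀ s : ℝ, Continuous fun x : Euc d => u (z + s • x) * η x := fun s => by
    have := hu.continuous
    fun_prop
  refine (hasDerivAt_integral_of_dominated_loc_of_deriv_le (s := univ)
    (F := fun (t : ℝ) x => u (z + t • x) * η x)
    (F' := fun (t : ℝ) x => fderiv ℝ u (z + t • x) x * η x)
    (bound := fun x => M * (‖x‖ * ‖η x‖)) univ_mem
    (Eventually.of_forall fun s => (hcomp s).aestronglyMeasurable) ?_ ?_ ?_ ?_ ?_).2
  · exact (hcomp t).integrable_of_hasCompactSupport hηc.mul_left
  · have : Continuous fun x : Euc d => fderiv ℝ u (z + t • x) x * η x := by fun_prop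
    exact this.aestronglyMeasurable
  · refine Eventually.of_forall fun x s _ => ?_
    rw [norm_mul, ← mul_assoc]
    gcongr
    exact (ContinuousLinearMap.le_opNorm _ _).trans (by gcongr; exact hM _)
  · refine Continuous.integrable_of_hasCompactSupport (by fun_prop) ?_
    exact (hηc.norm.mul_left (f := fun x => ‖x‖)).mul_left (f := fun _ => M)
  · refine Eventually.of_forall fun x s _ => ?_
    have h1 : HasDerivAt (fun t : ℝ => z + t • x) x s := by
      simpa using ((hasDerivAt_id s).smul_const x).const_add z
    have h2 : HasFDerivAt u (fderiv ℝ u (z + s • x)) (z + s • x) :=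
      (hu.differentiable (by norm_num) _).hasFDerivAt
    exact (h2.comp_hasDerivAt s h1).mul_const (η x)

lemma integral_fderiv_comp_smul_mul {d : ℕ} {u η ψ : Euc d → ℝ} (hu : ContDiff ℝ 2 u)
    (hη : Continuous η) (hηc : HasCompactSupport η) (hψ : ContDiff ℝ 1 ψ)
    (hψc : HasCompactSupport ψ)
    (hgrad : ∀ x i, fderiv ℝ ψ x (EuclideanSpace.single i 1) = 2 * (x i * η x))
    (z : Euc d) (t : ℝ) (hlap : ∀ x, ψ x ≠ 0 → lap u (z + t • x) = 0) :
    ∫ x, fderiv ℝ u (z + t • x) x * η x = 0 := by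
  have hfc : Continuous (fderiv ℝ u) := hu.continuous_fderiv (by norm_num)
  have hf1 : ContDiff ℝ 1 (fderiv ℝ u) := hu.fderiv_right (by norm_num)
  have hff : Continuous (fderiv ℝ (fderiv ℝ u)) := hf1.continuous_fderiv (by norm_num)
  have hψf : Continuous (fderiv ℝ ψ) := hψ.continuous_fderiv (by norm_num)
  have hψ0 := hψ.continuous
  have hdiff : ∀ (i : Fin d) (x : Euc d), HasFDerivAt
      (fun x => fderiv ℝ u (z + t • x) (EuclideanSpace.single i 1))
      ((ContinuousLinearMap.apply ℝ ℝ (EuclideanSpace.single i (1 : ℝ))).comp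
        ((fderiv ℝ (fderiv ℝ u) (z + t • x)).comp (t • ContinuousLinearMap.id ℝ (Euc d)))) x := by
    intro i x
    have h1 : HasFDerivAt (fun x : Euc d => z + t • x) (t • ContinuousLinearMap.id ℝ (Euc d)) x :=
      ((hasFDerivAt_id x).const_smul t).const_add z
    have h2 : HasFDerivAt (fderiv ℝ u) (fderiv ℝ (fderiv ℝ u) (z + t • x)) (z + t • x) :=
      (hf1.differentiable (by norm_num) _).hasFDerivAt
    exact (ContinuousLinearMap.apply ℝ ℝ
      (EuclideanSpace.single i (1 : ℝ))).hasFDerivAt.comp x (h2.comp x h1)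
  have hparts : ∀ i : Fin d,
      ∫ x, fderiv ℝ u (z + t • x) (EuclideanSpace.single i 1) * (2 * (x i * η x))
        = - ∫ x, t * fderiv ℝ (fderiv ℝ u) (z + t • x) (EuclideanSpace.single i 1)
            (EuclideanSpace.single i 1) * ψ x := by
    intro i
    have h := integral_mul_fderiv_eq_neg_fderiv_mul_of_integrable (μ := (volume : Measure (Euc d)))
      (f := fun x => fderiv ℝ u (z + t • x) (EuclideanSpace.single i 1)) (g := ψ)
      (v := EuclideanSpace.single i (1 : ℝ)) ?_ ?_ ?_
      (fun x _ => (hdiff i x).differentiableAt) (fun x _ => hψ.differentiable (by norm_num) x)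
    · simp only [hgrad] at h
      rw [h]
      congr 2
      ext x
      rw [(hdiff i x).fderiv]
      simp
    · simp only [(hdiff i _).fderiv]
      refine Continuous.integrable_of_hasCompactSupport ?_ hψc.mul_left
      simp only [ContinuousLinearMap.comp_apply, ContinuousLinearMap.apply_apply,
        smul_apply, ContinuousLinearMap.id_apply]
      fun_prop
    · refine Continuous.integrable_of_hasCompactSupport ?_
        (HasCompactSupport.mul_left (hψc.fderiv_apply (𝕜 := ℝ) _))
      fun_prop
    · refine Continuous.integrable_of_hasCompactSupport ?_ hψc.mul_left
      fun_prop
  have hsum : ∀ x : Euc d, fderiv ℝ u (z + t • x) x * η x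
      = 2⁻¹ * ∑ i, fderiv ℝ u (z + t • x) (EuclideanSpace.single i 1) * (2 * (x i * η x)) := by
    intro x
    have hx : x = ∑ i, x i • EuclideanSpace.single i (1 : ℝ) := by
      have := (EuclideanSpace.basisFun (Fin d) ℝ).sum_repr x
      simpa using this.symm
    conv_lhs => rw [show fderiv ℝ u (z + t • x) x
      = fderiv ℝ u (z + t • x) (∑ i, x i • EuclideanSpace.single i (1 : ℝ)) by rw [← hx]]
    rw [map_sum, Finset.sum_mul, Finset.mul_sum]
    refine Finset.sum_congr rfl fun i _ => ?_
    simp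
    ring
  simp_rw [hsum]
  rw [integral_const_mul, integral_finsetSum]
  · simp_rw [hparts]
    rw [Finset.sum_neg_distrib, ← integral_finsetSum]
    · have : ∀ x : Euc d, ∑ i, t * fderiv ℝ (fderiv ℝ u) (z + t • x) (EuclideanSpace.single i 1)
            (EuclideanSpace.single i 1) * ψ x = 0 := by
        intro x
        by_cases hx : ψ x = 0
        · simp [hx]
        · have := hlap x hx
          simp only [lap, iteratedFDeriv_two_apply, Matrix.cons_val_zero, Matrix.cons_val_one] at this
          rw [← Finset.sum_mul, ← Finset.mul_sum, this]
          simp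
      simp [this]
    · intro i _
      refine Continuous.integrable_of_hasCompactSupport ?_ hψc.mul_left
      fun_prop
  · intro i _
    refine Continuous.integrable_of_hasCompactSupport (by fun_prop) ?_
    exact HasCompactSupport.mul_left (HasCompactSupport.mul_left
      (hηc.mul_left))

lemma integral_comp_smul_mul_of_lap_eq_zero {d : ℕ} {u η ψ : Euc d → ℝ} (hu : ContDiff ℝ 2 u)
    (huc : HasCompactSupport u)
    (hη : Continuous η) (hηc : HasCompactSupport η) (hψ : ContDiff ℝ 1 ψ)
    (hψc : HasCompactSupport ψ)
    (hgrad : ∀ x i, fderiv ℝ ψ x (EuclideanSpace.single i 1) = 2 * (x i * η x))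
    (z : Euc d) {a : ℝ} (ha : 0 ≤ a)
    (hlap : ∀ t ∈ Icc 0 a, ∀ x, ψ x ≠ 0 → lap u (z + t • x) = 0) :
    ∫ x, u (z + a • x) * η x = u z * ∫ x, η x := by
  have hd := hasDerivAt_integral_comp_smul_mul (hu.of_le (by norm_num)) huc hη hηc z
  have h := constant_of_has_deriv_right_zero (f := fun t : ℝ => ∫ x, u (z + t • x) * η x)
    (a := 0) (b := a) (fun t _ => (hd t).continuousAt.continuousWithinAt) (fun t ht => by
      have := hd t
      rw [integral_fderiv_comp_smul_mul hu hη hηc hψ hψc hgrad z t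
        (hlap t (Ico_subset_Icc_self ht))] at this
      exact this.hasDerivWithinAt) a ⟨ha, le_rfl⟩
  rw [h]
  simp [integral_const_mul]

/-- A nonzero bump function whose weighted averages reproduce the values of harmonic functions. -/
structure IsMeanValueKernel {d : ℕ} (η : Euc d → ℝ) : Prop where
  isTestFun : IsTestFun η
  tsupport_subset : tsupport η ⊆ ball 0 1
  integral_pos : 0 < ∫ x, η x
  setIntegral_eq : ∀ (z : Euc d) (r : ℝ) (u : Euc d → ℝ), IsHarmonicOn u (ball z r) →
    ∀ a, 0 < a → a ≤ r →
      ∫ x in ball z r, u x * η (a⁻¹ • (x - z)) = a ^ d * (∫ x, η x) * u z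

lemma lap_congr {d : ℕ} {u v : Euc d → ℝ} {x : Euc d} (h : u =ᶠ[𝓝 x] v) : lap u x = lap v x := by
  simp only [lap, (h.iteratedFDeriv ℝ 2).eq_of_nhds]

lemma exists_hasCompactSupport_eqOn {d : ℕ} {u : Euc d → ℝ} {z : Euc d} {r : ℝ} (hr : 0 < r)
    (hu : ContDiffOn ℝ 2 u (ball z r)) :
    ∃ v : Euc d → ℝ, ContDiff ℝ 2 v ∧ HasCompactSupport v ∧ EqOn v u (ball z (r / 2)) := by
  let χ : ContDiffBump z := ⟨r / 2, 3 * r / 4, by positivity, by linarith⟩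
  have hsupp : tsupport (fun x => χ x * u x) ⊆ closedBall z (3 * r / 4) := by
    refine (tsupport_mul_subset_left).trans ?_
    rw [χ.tsupport_eq]
  refine ⟨fun x => χ x * u x, ?_, χ.hasCompactSupport.mul_right, fun x hx => ?_⟩
  · refine contDiff_iff_contDiffAt.2 fun x => ?_
    by_cases hx : x ∈ ball z r
    · exact χ.contDiff.contDiffAt.mul (hu.contDiffAt (isOpen_ball.mem_nhds hx))
    · refine (contDiffAt_const (c := (0 : ℝ))).congr_of_eventuallyEq
        (notMem_tsupport_iff_eventuallyEq.1 fun h => hx ?_)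
      exact closedBall_subset_ball (by linarith) (hsupp h)
  · change χ x * u x = u x
    rw [χ.one_of_mem_closedBall (ball_subset_closedBall hx), one_mul]

lemma exists_primitive_normSq {d : ℕ} {ρ : ℝ → ℝ} (hρ : Continuous ρ) {c : ℝ}
    (hc : ∀ s, c ≤ s → ρ s = 0) :
    ∃ ψ : Euc d → ℝ, ContDiff ℝ 1 ψ ∧ (∀ x, c ≤ ‖x‖ ^ 2 → ψ x = 0) ∧
      ∀ x i, fderiv ℝ ψ x (EuclideanSpace.single i 1) = 2 * (x i * ρ (‖x‖ ^ 2)) := by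
  have hΨ : ∀ s, HasDerivAt (fun s => ∫ y in c..s, ρ y) (ρ s) s := fun s =>
    intervalIntegral.integral_hasDerivAt_right (hρ.intervalIntegrable _ _)
      (hρ.stronglyMeasurableAtFilter _ _) hρ.continuousAt
  have hΨ1 : ContDiff ℝ 1 (fun s => ∫ y in c..s, ρ y) := by
    refine contDiff_one_iff_deriv.2 ⟨fun s => (hΨ s).differentiableAt, ?_⟩
    rwa [funext fun s => (hΨ s).deriv]
  refine ⟨fun x => ∫ y in c..‖x‖ ^ 2, ρ y, hΨ1.comp (contDiff_norm_sq ℝ), fun x hx => ?_,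
    fun x i => ?_⟩
  · refine intervalIntegral.integral_zero_ae (Eventually.of_forall fun y hy => hc y ?_)
    rw [uIoc_of_le hx] at hy
    exact hy.1.le
  · have h1 : HasFDerivAt (fun x : Euc d => ‖x‖ ^ 2) (2 • innerSL ℝ x) x :=
      (hasStrictFDerivAt_norm_sq x).hasFDerivAt
    have h2 := (hΨ (‖x‖ ^ 2)).comp_hasFDerivAt x h1
    have h3 := h2.fderiv
    change fderiv ℝ (fun x : Euc d => ∫ y in c..‖x‖ ^ 2, ρ y) x = _ at h3
    rw [h3]
    simp [EuclideanSpace.inner_single_right]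
    ring

lemma exists_isMeanValueKernel (d : ℕ) : ∃ η : Euc d → ℝ, IsMeanValueKernel η := by
  let ρ : ContDiffBump (0 : ℝ) := ⟨1 / 8, 1 / 4, by norm_num, by norm_num⟩
  have hρ0 : ∀ s, 1 / 4 ≤ s → ρ s = 0 := fun s hs => ρ.zero_of_le_dist (by
    rw [Real.dist_eq, sub_zero, abs_of_nonneg (by linarith)]; exact hs)
  obtain ⟨ψ, hψ, hψ0, hgrad⟩ := exists_primitive_normSq (d := d) ρ.continuous hρ0
  let η : Euc d → ℝ := fun x => ρ (‖x‖ ^ 2)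
  have hsq : ∀ x : Euc d, x ∉ closedBall (0 : Euc d) (1 / 2) → 1 / 4 ≤ ‖x‖ ^ 2 := by
    intro x hx
    rw [mem_closedBall_zero_iff, not_le] at hx
    nlinarith
  have hη0 : ∀ x, x ∉ closedBall (0 : Euc d) (1 / 2) → η x = 0 := fun x hx => hρ0 _ (hsq x hx)
  have hηd : ContDiff ℝ (⊤ : ℕ∞) η := ρ.contDiff.comp (contDiff_norm_sq ℝ)
  have hηc : HasCompactSupport η := HasCompactSupport.intro (isCompact_closedBall _ _) hη0
  have hψc : HasCompactSupport ψ :=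
    HasCompactSupport.intro (isCompact_closedBall 0 (1 / 2)) fun x hx => hψ0 x (hsq x hx)
  have hts : tsupport η ⊆ closedBall 0 (1 / 2) :=
    closure_minimal (fun x hx => by_contra fun h => hx (hη0 x h)) isClosed_closedBall
  refine ⟨η, ⟨hηd, hηc⟩, hts.trans (closedBall_subset_ball (by norm_num)), ?_, ?_⟩
  · refine hηd.continuous.integral_pos_of_hasCompactSupport_nonneg_nonzero hηc
      (fun x => ρ.nonneg) (x := 0) ?_
    have : η 0 = 1 := ρ.one_of_mem_closedBall (by simp [ρ])
    simp [this]
  · intro z r u hu a ha har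
    obtain ⟨v, hv, hvc, hvu⟩ := exists_hasCompactSupport_eqOn (ha.trans_le har) hu.1
    have hball : ∀ x : Euc d, 1 / 4 > ‖x‖ ^ 2 → ‖x‖ < 1 / 2 := fun x hx =>
      lt_of_pow_lt_pow_left₀ 2 (by norm_num) (by linarith)
    have hmem : ∀ t ∈ Icc 0 a, ∀ x : Euc d, 1 / 4 > ‖x‖ ^ 2 → z + t • x ∈ ball z (r / 2) := by
      intro t ht x hx
      rw [mem_ball, dist_self_add_left, norm_smul, Real.norm_of_nonneg ht.1]
      have := hball x hx
      have := norm_nonneg x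
      nlinarith [ht.1, ht.2]
    have key := integral_comp_smul_mul_of_lap_eq_zero hv hvc hηd.continuous hηc hψ hψc hgrad z
      ha.le (fun t ht x hx => by
        have hx' := hmem t ht x (by by_contra h; exact hx (hψ0 x (not_lt.1 h)))
        rw [lap_congr (hvu.eventuallyEq_of_mem (isOpen_ball.mem_nhds hx'))]
        exact hu.2 _ (ball_subset_ball (by linarith) hx'))
    have hvz : v z = u z := hvu (mem_ball_self (by linarith))
    have h0 : ∀ x, x ∉ ball z (r / 2) → η (a⁻¹ • (x - z)) = 0 := by
      intro x hx
      by_contra hne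
      have h1 : 1 / 4 > ‖a⁻¹ • (x - z)‖ ^ 2 := by
        by_contra h; exact hne (hρ0 _ (not_lt.1 h))
      refine hx ?_
      have := hmem a ⟨ha.le, le_rfl⟩ _ h1
      rwa [smul_inv_smul₀ ha.ne', add_sub_cancel] at this
    have e1 : ∫ x in ball z r, u x * η (a⁻¹ • (x - z)) = ∫ x, v x * η (a⁻¹ • (x - z)) := by
      rw [← integral_indicator measurableSet_ball]
      congr 1
      ext x
      by_cases hx : x ∈ ball z (r / 2)
      · rw [indicator_of_mem (ball_subset_ball (by linarith) hx), hvu hx]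
      · simp only [indicator, h0 x hx, mul_zero, ite_self]
    have e2 : ∫ x, v x * η (a⁻¹ • (x - z)) = ∫ y, v (z + a • (a⁻¹ • y)) * η (a⁻¹ • y) := by
      rw [← integral_add_right_eq_self _ z]
      refine integral_congr_ae (Eventually.of_forall fun x => ?_)
      simp [smul_inv_smul₀ ha.ne', add_comm]
    rw [e1, e2, Measure.integral_comp_inv_smul_of_nonneg (μ := volume)
      (fun y => v (z + a • y) * η y) ha.le, key, hvz]
    simp
    ring

section Moments

variable {Ω : Type*} [MeasurableSpace Ω] {P : Measure Ω} {Y Z : Ω → ℝ}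

lemma integrable_pow_of_integrable_pow_four [IsProbabilityMeasure P] (hY : Measurable Y)
    (h4 : Integrable (fun ω => Y ω ^ 4) P) {k : ℕ} (hk : k ≤ 4) :
    Integrable (fun ω => Y ω ^ k) P := by
  refine ((integrable_const (1 : ℝ)).add h4).mono' (hY.pow_const k).aestronglyMeasurable
    (Eventually.of_forall fun ω => ?_)
  have e : Y ω ^ 4 = |Y ω| ^ 4 := by rw [← abs_pow, abs_of_nonneg (by positivity)]
  rw [Real.norm_eq_abs, abs_pow, Pi.add_apply, e]
  rcases le_total |Y ω| 1 with h | h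
  · have := pow_le_one₀ (n := k) (abs_nonneg _) h
    have : 0 ≤ |Y ω| ^ 4 := by positivity
    linarith
  · have := pow_le_pow_right₀ h hk
    linarith

lemma IndepFun.integral_pow_mul_pow [IsProbabilityMeasure P] (h : IndepFun Y Z P) (hY : Measurable Y) (hZ : Measurable Z)
    (hY4 : Integrable (fun ω => Y ω ^ 4) P) (hZ4 : Integrable (fun ω => Z ω ^ 4) P)
    {j k : ℕ} (hj : j ≤ 4) (hk : k ≤ 4) :
    Integrable (fun ω => Y ω ^ j * Z ω ^ k) P ∧
      ∫ ω, Y ω ^ j * Z ω ^ k ∂P = (∫ ω, Y ω ^ j ∂P) * ∫ ω, Z ω ^ k ∂P := by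
  have hI : IndepFun (fun ω => Y ω ^ j) (fun ω => Z ω ^ k) P :=
    h.comp (measurable_id.pow_const j) (measurable_id.pow_const k)
  have hYj := integrable_pow_of_integrable_pow_four hY hY4 hj
  have hZk := integrable_pow_of_integrable_pow_four hZ hZ4 hk
  exact ⟨hI.integrable_mul hYj hZk,
    hI.integral_fun_mul_eq_mul_integral hYj.aestronglyMeasurable hZk.aestronglyMeasurable⟩

lemma IndepFun.integral_add_sq [IsProbabilityMeasure P] (h : IndepFun Y Z P) (hY : Measurable Y) (hZ : Measurable Z)
    (hY4 : Integrable (fun ω => Y ω ^ 4) P) (hZ4 : Integrable (fun ω => Z ω ^ 4) P)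
    (hY0 : ∫ ω, Y ω ∂P = 0) :
    ∫ ω, (Y ω + Z ω) ^ 2 ∂P = ∫ ω, Y ω ^ 2 ∂P + ∫ ω, Z ω ^ 2 ∂P := by
  have h2 := integrable_pow_of_integrable_pow_four hY hY4 (k := 2) (by norm_num)
  have h2' := integrable_pow_of_integrable_pow_four hZ hZ4 (k := 2) (by norm_num)
  obtain ⟨hi, he⟩ := IndepFun.integral_pow_mul_pow h hY hZ hY4 hZ4 (j := 1) (k := 1)
    (by norm_num) (by norm_num)
  have hex : ∀ ω, (Y ω + Z ω) ^ 2 = Y ω ^ 2 + 2 * (Y ω ^ 1 * Z ω ^ 1) + Z ω ^ 2 := fun ω => by ring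
  simp_rw [hex]
  have hs : Integrable (fun ω => Y ω ^ 2 + 2 * (Y ω ^ 1 * Z ω ^ 1)) P := h2.add (hi.const_mul 2)
  rw [integral_add hs h2', integral_add h2 (hi.const_mul 2),
    integral_const_mul, he]
  simp [hY0]

lemma IndepFun.integral_add_pow_four [IsProbabilityMeasure P] (h : IndepFun Y Z P) (hY : Measurable Y) (hZ : Measurable Z)
    (hY4 : Integrable (fun ω => Y ω ^ 4) P) (hZ4 : Integrable (fun ω => Z ω ^ 4) P)
    (hY0 : ∫ ω, Y ω ∂P = 0) (hZ0 : ∫ ω, Z ω ∂P = 0) :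
    ∫ ω, (Y ω + Z ω) ^ 4 ∂P = ∫ ω, Y ω ^ 4 ∂P
      + 6 * ((∫ ω, Y ω ^ 2 ∂P) * ∫ ω, Z ω ^ 2 ∂P) + ∫ ω, Z ω ^ 4 ∂P := by
  obtain ⟨i1, e1⟩ := IndepFun.integral_pow_mul_pow h hY hZ hY4 hZ4 (j := 3) (k := 1)
    (by norm_num) (by norm_num)
  obtain ⟨i2, e2⟩ := IndepFun.integral_pow_mul_pow h hY hZ hY4 hZ4 (j := 2) (k := 2)
    (by norm_num) (by norm_num)
  obtain ⟨i3, e3⟩ := IndepFun.integral_pow_mul_pow h hY hZ hY4 hZ4 (j := 1) (k := 3)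
    (by norm_num) (by norm_num)
  have hex : ∀ ω, (Y ω + Z ω) ^ 4 = (Y ω ^ 4 + 4 * (Y ω ^ 3 * Z ω ^ 1)
      + 6 * (Y ω ^ 2 * Z ω ^ 2) + 4 * (Y ω ^ 1 * Z ω ^ 3)) + Z ω ^ 4 := fun ω => by ring
  simp_rw [hex]
  have a1 : Integrable (fun ω => Y ω ^ 4 + 4 * (Y ω ^ 3 * Z ω ^ 1)) P := hY4.add (i1.const_mul 4)
  have a2 : Integrable (fun ω => Y ω ^ 4 + 4 * (Y ω ^ 3 * Z ω ^ 1)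
      + 6 * (Y ω ^ 2 * Z ω ^ 2)) P := a1.add (i2.const_mul 6)
  have a3 : Integrable (fun ω => Y ω ^ 4 + 4 * (Y ω ^ 3 * Z ω ^ 1)
      + 6 * (Y ω ^ 2 * Z ω ^ 2) + 4 * (Y ω ^ 1 * Z ω ^ 3)) P := a2.add (i3.const_mul 4)
  rw [integral_add a3 hZ4, integral_add a2 (i3.const_mul 4), integral_add a1 (i2.const_mul 6),
    integral_add hY4 (i1.const_mul 4)]
  simp only [integral_const_mul, e1, e2, e3]
  simp only [pow_one, hY0, hZ0]
  ring

/-- Hölder's inequality for a product of four random variables. -/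
lemma abs_integral_prod_pow_four_le {Y : Fin 4 → Ω → ℝ} (hY : ∀ i, Measurable (Y i))
    (h4 : ∀ i, Integrable (fun ω => Y i ω ^ 4) P) :
    |∫ ω, ∏ i, Y i ω ∂P| ^ 4 ≤ ∏ i, ∫ ω, Y i ω ^ 4 ∂P := by
  have hnn : ∀ i ω, 0 ≤ Y i ω ^ 4 := fun i ω => by positivity
  have hI : ∀ i, ∫⁻ ω, ENNReal.ofReal (Y i ω ^ 4) ∂P = ENNReal.ofReal (∫ ω, Y i ω ^ 4 ∂P) :=
    fun i => (ofReal_integral_eq_lintegral_ofReal (h4 i) (Eventually.of_forall (hnn i))).symm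
  have holder := ENNReal.lintegral_prod_norm_pow_le (μ := P) Finset.univ
    (f := fun i ω => ENNReal.ofReal (Y i ω ^ 4))
    (fun i _ => ((hY i).pow_const 4).ennreal_ofReal.aemeasurable)
    (p := fun _ => (1 / 4 : ℝ)) (by norm_num) (fun _ _ => by norm_num)
  have hroot : ∀ i ω, ENNReal.ofReal (Y i ω ^ 4) ^ (1 / 4 : ℝ) = ‖Y i ω‖ₑ := by
    intro i ω
    rw [Real.enorm_eq_ofReal_abs, ENNReal.ofReal_rpow_of_nonneg (hnn i ω) (by norm_num)]
    congr 1
    have : Y i ω ^ 4 = |Y i ω| ^ (4 : ℝ) := by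
      rw [show (4 : ℝ) = ((4 : ℕ) : ℝ) by norm_num, Real.rpow_natCast, ← abs_pow,
        abs_of_nonneg (hnn i ω)]
    rw [this, ← Real.rpow_mul (abs_nonneg _)]
    norm_num
  simp_rw [hroot, hI] at holder
  have h1 : ‖∫ ω, ∏ i, Y i ω ∂P‖ₑ ≤ ∏ i, ENNReal.ofReal (∫ ω, Y i ω ^ 4 ∂P) ^ (1 / 4 : ℝ) := by
    refine (enorm_integral_le_lintegral_enorm _).trans (le_trans (le_of_eq ?_) holder)
    refine lintegral_congr fun ω => ?_
    rw [Real.enorm_eq_ofReal_abs, Finset.abs_prod,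
      ENNReal.ofReal_prod_of_nonneg (fun _ _ => abs_nonneg _)]
    simp_rw [Real.enorm_eq_ofReal_abs]
  have h2 := pow_le_pow_left₀ (zero_le) h1 4
  rw [← Finset.prod_pow] at h2
  have h3 : ∀ x : ENNReal, (x ^ (1 / 4 : ℝ)) ^ 4 = x := by
    intro x
    rw [← ENNReal.rpow_natCast, ← ENNReal.rpow_mul]
    norm_num
  simp_rw [h3] at h2
  rw [← ENNReal.ofReal_prod_of_nonneg (fun i _ => integral_nonneg (hnn i)),
    Real.enorm_eq_ofReal_abs, ← ENNReal.ofReal_pow (abs_nonneg _)] at h2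
  exact (ENNReal.ofReal_le_ofReal_iff
    (Finset.prod_nonneg fun i _ => integral_nonneg (hnn i))).1 h2

lemma identDistrib_of_map_fin_one_eq (hY : Measurable Y) (hZ : Measurable Z)
    (h : Measure.map (fun ω (_ : Fin 1) => Y ω) P = Measure.map (fun ω (_ : Fin 1) => Z ω) P) :
    IdentDistrib Y Z P P := by
  have : IdentDistrib (fun ω (_ : Fin 1) => Y ω) (fun ω (_ : Fin 1) => Z ω) P P :=
    ⟨(measurable_pi_lambda _ fun _ => hY).aemeasurable,
      (measurable_pi_lambda _ fun _ => hZ).aemeasurable, h⟩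
  exact this.comp (measurable_pi_apply (0 : Fin 1))

end Moments

/-- The function `η` rescaled to live at scale `a` around `z`. -/
def rescale {d : ℕ} (η : Euc d → ℝ) (z : Euc d) (a : ℝ) (x : Euc d) : ℝ := η (a⁻¹ • (x - z))

lemma rescale_comp {d : ℕ} (η : Euc d → ℝ) (w a : Euc d) (b : ℝ) {r : ℝ} (hr : r ≠ 0) :
    (fun x => rescale η w b (r⁻¹ • (x - a))) = rescale η (a + r • w) (r * b) := by
  ext x
  simp only [rescale]
  congr 1
  rw [mul_inv_rev, mul_smul, ← sub_sub, smul_sub r⁻¹ (x - a), inv_smul_smul₀ hr]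

lemma tsupport_rescale_subset {d : ℕ} {η : Euc d → ℝ} (hη : tsupport η ⊆ ball 0 1) (z : Euc d)
    {a : ℝ} (ha : 0 < a) : tsupport (rescale η z a) ⊆ ball z a := by
  intro x hx
  have hc : Continuous fun x : Euc d => a⁻¹ • (x - z) := by fun_prop
  have := hη (tsupport_comp_subset_preimage η hc hx)
  rw [mem_ball_zero_iff, norm_smul, norm_inv, Real.norm_of_nonneg ha.le, ← dist_eq_norm,
    inv_mul_lt_one₀ ha] at this
  exact this

lemma IsTestFun.rescale {d : ℕ} {η : Euc d → ℝ} (hη : IsTestFun η) (z : Euc d) {a : ℝ}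
    (ha : 0 < a) : IsTestFun (rescale η z a) := by
  refine ⟨hη.1.comp ((contDiff_id.sub contDiff_const).const_smul a⁻¹), ?_⟩
  exact hη.2.comp_homeomorph
    ((Homeomorph.subRight z).trans (Homeomorph.smulOfNeZero a⁻¹ (inv_ne_zero ha.ne')))

namespace GFF

variable {d : ℕ} {Ω : Type} [MeasurableSpace Ω] (X : GFF d Ω)

lemma identDistrib_H {a : Euc d} {r : ℝ} (hr : 0 < r) (hb : ball a r ⊆ ball 0 1)
    {η : Euc d → ℝ} (hη : IsTestFun η) :
    IdentDistrib (X.H a r (rescale η a r)) (fun ω => r ^ (1 + (d : ℝ) / 2) * X.h 0 1 η ω)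
      X.P X.P := by
  have h1 := X.dmp_law a r hr hb 1 (fun _ => rescale η a r) fun _ => hη.rescale a hr
  have h2 := X.scaling a r hr 1 (fun _ => η) fun _ => hη
  exact (identDistrib_of_map_fin_one_eq (X.meas_H _ _ _) (X.meas_h _ _ _) h1).trans
    (identDistrib_of_map_fin_one_eq (X.meas_h _ _ _) ((X.meas_h _ _ _).const_mul _) h2)

lemma integral_H_pow {a : Euc d} {r : ℝ} (hr : 0 < r) (hb : ball a r ⊆ ball 0 1)
    {η : Euc d → ℝ} (hη : IsTestFun η) (k : ℕ) :
    ∫ ω, X.H a r (rescale η a r) ω ^ (2 * k) ∂X.P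
      = (r ^ (2 + d)) ^ k * ∫ ω, X.h 0 1 η ω ^ (2 * k) ∂X.P := by
  have h := ((X.identDistrib_H hr hb hη).comp (measurable_id.pow_const (2 * k))).integral_eq
  have hs : (r ^ (1 + (d : ℝ) / 2)) ^ 2 = r ^ (2 + d) := by
    rw [← Real.rpow_natCast, ← Real.rpow_mul hr.le, ← Real.rpow_natCast]
    congr 1
    push_cast
    ring
  simp only [Function.comp_def, id, mul_pow] at h
  rw [h, integral_const_mul, pow_mul, hs]

lemma rescale_eq_rescale {a : Euc d} {r : ℝ} (hr : 0 < r) (f : Euc d → ℝ) :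
    f = rescale (rescale f (-(r⁻¹ • a)) r⁻¹) a r := by
  have := rescale_comp f (-(r⁻¹ • a)) a r⁻¹ hr.ne'
  ext x
  refine Eq.trans ?_ (congrFun this.symm x)
  rw [smul_neg, smul_inv_smul₀ hr.ne', add_neg_cancel, mul_inv_cancel₀ hr.ne']
  simp [rescale]

lemma integrable_H_pow_four {a : Euc d} {r : ℝ} (hr : 0 < r) (hb : ball a r ⊆ ball 0 1)
    {f : Euc d → ℝ} (hf : IsTestFun f) : Integrable (fun ω => X.H a r f ω ^ 4) X.P := by
  rw [rescale_eq_rescale (a := a) hr f]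
  have hη : IsTestFun (rescale f (-(r⁻¹ • a)) r⁻¹) := hf.rescale _ (inv_pos.2 hr)
  have h := (X.identDistrib_H hr hb hη).comp (measurable_id.pow_const 4)
  refine h.integrable_iff.2 ?_
  simp only [Function.comp_def, id, mul_pow]
  exact (X.mom4 _ hη).const_mul _

lemma integral_H {a : Euc d} {r : ℝ} (hr : 0 < r) (hb : ball a r ⊆ ball 0 1)
    {f : Euc d → ℝ} (hf : IsTestFun f) : ∫ ω, X.H a r f ω ∂X.P = 0 := by
  have h1 := X.dmp_law a r hr hb 1 (fun _ => f) fun _ => hf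
  rw [(identDistrib_of_map_fin_one_eq (X.meas_H _ _ _) (X.meas_h _ _ _) h1).integral_eq,
    X.centered _ _ _ hf]

lemma integrable_Φ_pow_four {a : Euc d} {r : ℝ} (hr : 0 < r) (hb : ball a r ⊆ ball 0 1)
    {f : Euc d → ℝ} (hf : IsTestFun f) : Integrable (fun ω => X.Φ a r f ω ^ 4) X.P := by
  refine (((X.mom4 f hf).add (X.integrable_H_pow_four hr hb hf)).const_mul 8).mono'
    ((X.meas_Φ a r f).pow_const 4).aestronglyMeasurable ?_
  filter_upwards [X.dmp_decomp a r hr hb f hf] with ω hω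
  have : X.Φ a r f ω = X.h 0 1 f ω - X.H a r f ω := by linarith
  rw [Real.norm_of_nonneg (by positivity), this, Pi.add_apply]
  generalize X.h 0 1 f ω = p
  generalize X.H a r f ω = q
  nlinarith [sq_nonneg (p ^ 2 - q ^ 2), sq_nonneg (p + q), sq_nonneg (p * (p + q)),
    sq_nonneg (q * (p + q)), sq_nonneg ((p + q) ^ 2), sq_nonneg (p ^ 2 + q ^ 2 + 2 * p * q)]

lemma integral_Φ {a : Euc d} {r : ℝ} (hr : 0 < r) (hb : ball a r ⊆ ball 0 1)
    {f : Euc d → ℝ} (hf : IsTestFun f) : ∫ ω, X.Φ a r f ω ∂X.P = 0 := by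
  have hH := integrable_pow_of_integrable_pow_four (X.meas_H a r f)
    (X.integrable_H_pow_four hr hb hf) (k := 1) (by norm_num)
  simp only [pow_one] at hH
  have : X.Φ a r f =ᵐ[X.P] fun ω => X.h 0 1 f ω - X.H a r f ω := by
    filter_upwards [X.dmp_decomp a r hr hb f hf] with ω hω
    linarith
  rw [integral_congr_ae this, integral_sub (X.integrable_h 0 1 f hf) hH, X.centered 0 1 f hf,
    X.integral_H hr hb hf, sub_zero]

lemma indepFun_H_Φ {a : Euc d} {r : ℝ} (hr : 0 < r) (hb : ball a r ⊆ ball 0 1)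
    {f : Euc d → ℝ} (hf : IsTestFun f) : IndepFun (X.H a r f) (X.Φ a r f) X.P := by
  refine indep_of_indep_of_le_left (indep_of_indep_of_le_right (X.dmp_indep a r hr hb) ?_) ?_
  · exact le_sup_of_le_left (le_iSup (fun f : {f : Euc d → ℝ // IsTestFun f} =>
      MeasurableSpace.comap (X.Φ a r f.1) inferInstance) ⟨f, hf⟩)
  · exact le_iSup (fun f : {f : Euc d → ℝ // IsTestFun f} =>
      MeasurableSpace.comap (X.H a r f.1) inferInstance) ⟨f, hf⟩

lemma integral_h_sq {a : Euc d} {r : ℝ} (hr : 0 < r) (hb : ball a r ⊆ ball 0 1)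
    {f : Euc d → ℝ} (hf : IsTestFun f) :
    ∫ ω, X.h 0 1 f ω ^ 2 ∂X.P = ∫ ω, X.H a r f ω ^ 2 ∂X.P + ∫ ω, X.Φ a r f ω ^ 2 ∂X.P := by
  rw [← IndepFun.integral_add_sq (X.indepFun_H_Φ hr hb hf) (X.meas_H _ _ _) (X.meas_Φ _ _ _)
    (X.integrable_H_pow_four hr hb hf) (X.integrable_Φ_pow_four hr hb hf) (X.integral_H hr hb hf)]
  refine integral_congr_ae ?_
  filter_upwards [X.dmp_decomp a r hr hb f hf] with ω hω
  rw [hω]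

lemma integral_h_pow_four {a : Euc d} {r : ℝ} (hr : 0 < r) (hb : ball a r ⊆ ball 0 1)
    {f : Euc d → ℝ} (hf : IsTestFun f) :
    ∫ ω, X.h 0 1 f ω ^ 4 ∂X.P = ∫ ω, X.H a r f ω ^ 4 ∂X.P
      + 6 * ((∫ ω, X.H a r f ω ^ 2 ∂X.P) * ∫ ω, X.Φ a r f ω ^ 2 ∂X.P)
      + ∫ ω, X.Φ a r f ω ^ 4 ∂X.P := by
  rw [← IndepFun.integral_add_pow_four (X.indepFun_H_Φ hr hb hf) (X.meas_H _ _ _) (X.meas_Φ _ _ _)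
    (X.integrable_H_pow_four hr hb hf) (X.integrable_Φ_pow_four hr hb hf) (X.integral_H hr hb hf)
    (X.integral_Φ hr hb hf)]
  refine integral_congr_ae ?_
  filter_upwards [X.dmp_decomp a r hr hb f hf] with ω hω
  rw [hω]

lemma integral_H_pow_four_le {a : Euc d} {r : ℝ} (hr : 0 < r) (hb : ball a r ⊆ ball 0 1)
    {f : Euc d → ℝ} (hf : IsTestFun f) :
    ∫ ω, X.H a r f ω ^ 4 ∂X.P ≤ ∫ ω, X.h 0 1 f ω ^ 4 ∂X.P := by
  rw [X.integral_h_pow_four hr hb hf, add_assoc]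
  exact le_add_of_nonneg_right (by positivity)

lemma integral_Φ_pow_four_le {a : Euc d} {r : ℝ} (hr : 0 < r) (hb : ball a r ⊆ ball 0 1)
    {f : Euc d → ℝ} (hf : IsTestFun f) :
    ∫ ω, X.Φ a r f ω ^ 4 ∂X.P ≤ ∫ ω, X.h 0 1 f ω ^ 4 ∂X.P := by
  rw [X.integral_h_pow_four hr hb hf]
  exact le_add_of_nonneg_left (by positivity)

lemma Φ_rescale_ae_eq {η : Euc d → ℝ} (hη : IsMeanValueKernel η) {z : Euc d} {r : ℝ}
    (hb : ball z r ⊆ ball 0 1) {a : ℝ} (ha : 0 < a) (har : a ≤ r) :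
    X.Φ z r (rescale η z a) =ᵐ[X.P] fun ω => a ^ d * (∫ x, η x) * X.φharm z r ω z := by
  filter_upwards [X.dmp_harm z r (ha.trans_le har) hb] with ω hω
  rw [hω.2 _ (hη.isTestFun.rescale z ha)
    ((tsupport_rescale_subset hη.tsupport_subset z ha).trans (ball_subset_ball har))]
  exact hη.setIntegral_eq z r _ hω.1 a ha har

lemma integral_Φ_rescale_pow {η : Euc d → ℝ} (hη : IsMeanValueKernel η) {z : Euc d} {r : ℝ}
    (hb : ball z r ⊆ ball 0 1) {a : ℝ} (ha : 0 < a) (har : a ≤ r) (k : ℕ) :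
    ∫ ω, X.Φ z r (rescale η z a) ω ^ k ∂X.P
      = (a ^ d * ∫ x, η x) ^ k * ∫ ω, X.φharm z r ω z ^ k ∂X.P := by
  rw [← integral_const_mul]
  refine integral_congr_ae ?_
  filter_upwards [X.Φ_rescale_ae_eq hη hb ha har] with ω hω
  rw [hω, mul_pow]

lemma integrable_φharm_pow_four {η : Euc d → ℝ} (hη : IsMeanValueKernel η) {z : Euc d} {r : ℝ}
    (hr : 0 < r) (hb : ball z r ⊆ ball 0 1) :
    Integrable (fun ω => X.φharm z r ω z ^ 4) X.P := by
  have h := X.integrable_Φ_pow_four hr hb (hη.isTestFun.rescale z hr)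
  have hc : (r ^ d * ∫ x, η x) ^ 4 ≠ 0 := by
    have := hη.integral_pos
    positivity
  refine (h.const_mul ((r ^ d * ∫ x, η x) ^ 4)⁻¹).congr ?_
  filter_upwards [X.Φ_rescale_ae_eq hη hb hr le_rfl] with ω hω
  rw [hω, mul_pow (r ^ d * _), inv_mul_cancel_left₀ hc]

end GFF

section Growth

/-- The growth rate of the fourth moment at scale `2⁻ⁿ`. -/
def momentGrowth (d n : ℕ) : ℝ := if d = 2 then ((n : ℝ) + 1) ^ 2 else ((2 ^ (d - 2)) ^ n) ^ 2

lemma exists_le_mul_momentGrowth {d : ℕ} (hd : 2 ≤ d) {V A : ℕ → ℝ} {c m : ℝ} (hc : 0 ≤ c)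
    (hm : 0 ≤ m) (hV0 : 0 ≤ V 0) (hA0 : 0 ≤ A 0)
    (hV : ∀ n, V (n + 1) = 2 ^ (d - 2) * V n + c)
    (hA : ∀ n, A (n + 1) = (2 ^ (d - 2)) ^ 2 * A n + 6 * (2 ^ (d - 2) * V n * c) + m) :
    ∃ K, 0 ≤ K ∧ ∀ n, A n ≤ K * momentGrowth d n := by
  obtain ⟨L, hL⟩ : ∃ L, L = V 0 + c := ⟨_, rfl⟩
  obtain ⟨M, hM⟩ : ∃ M, M = 6 * (L * c) + m := ⟨_, rfl⟩
  have hL0 : 0 ≤ L := by rw [hL]; positivity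
  have hM0 : 0 ≤ M := by rw [hM]; positivity
  refine ⟨A 0 + M, by positivity, ?_⟩
  rcases hd.eq_or_lt with rfl | hd
  · simp only [momentGrowth, if_true]
    have hVn : ∀ n : ℕ, V n ≤ L * (n + 1) := by
      intro n
      induction n with
      | zero => simp [hL, hc]
      | succ n ih =>
        rw [hV]
        push_cast
        norm_num
        linarith
    intro n
    induction n with
    | zero => simp [hM0]
    | succ n ih =>
      rw [hA]
      have h1 := mul_le_mul_of_nonneg_right (hVn n) hc
      have hn : (0 : ℝ) ≤ n := n.cast_nonneg
      push_cast
      norm_num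
      nlinarith [mul_nonneg hm hn, mul_nonneg hA0 hn]
  · have hne : d ≠ 2 := hd.ne'
    simp only [momentGrowth, if_neg hne]
    obtain ⟨Q, hQ⟩ : ∃ Q : ℝ, Q = 2 ^ (d - 2) := ⟨_, rfl⟩
    have hQ2 : 2 ≤ Q := by
      rw [hQ]
      calc (2 : ℝ) = 2 ^ 1 := by norm_num
        _ ≤ 2 ^ (d - 2) := pow_le_pow_right₀ (by norm_num) (by omega)
    simp only [← hQ] at hV hA ⊢
    have hVn : ∀ n : ℕ, V n ≤ L * Q ^ n - c := by
      intro n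
      induction n with
      | zero => simp [hL]
      | succ n ih =>
        rw [hV, pow_succ]
        nlinarith
    have hAn : ∀ n : ℕ, A n ≤ (A 0 + M) * (Q ^ n) ^ 2 - M * Q ^ n := by
      intro n
      induction n with
      | zero => simp
      | succ n ih =>
        rw [hA, pow_succ Q n]
        have hq : 1 ≤ Q ^ n := one_le_pow₀ (by linarith)
        have h0 : V n ≤ L * Q ^ n := by linarith [hVn n]
        generalize Q ^ n = q at *
        have h1 := mul_le_mul_of_nonneg_left ih (by positivity : 0 ≤ Q ^ 2)
        have h2 : Q * V n * c ≤ Q * (L * q) * c := by gcongr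
        have h3 : m ≤ m * (Q * q) := le_mul_of_one_le_right hm (by nlinarith)
        have h4 : M * (Q * q) ≤ M * (Q * q) * (Q - 1) :=
          le_mul_of_one_le_right (by positivity) (by linarith)
        have h5 : M * (Q * q) = 6 * (Q * (L * q) * c) + m * (Q * q) := by rw [hM]; ring
        nlinarith
    intro n
    have : 0 ≤ M * Q ^ n := by positivity
    linarith [hAn n]

end Growth

namespace GFF

variable {d : ℕ} {Ω : Type} [MeasurableSpace Ω] (X : GFF d Ω)

lemma ball_zero_half_subset : ball (0 : Euc d) 2⁻¹ ⊆ ball 0 1 := ball_subset_ball (by norm_num)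

lemma rescale_zero_half (η : Euc d → ℝ) {a : ℝ} :
    rescale η 0 (a / 2) = rescale (rescale η 0 a) 0 2⁻¹ := by
  have := rescale_comp η 0 0 a (r := 2⁻¹) (by norm_num)
  rw [smul_zero, add_zero] at this
  rw [div_eq_inv_mul, ← this]
  rfl

lemma integral_h_rescale_sq {η : Euc d → ℝ} (hη : IsMeanValueKernel η) {a : ℝ} (ha : 0 < a)
    (ha1 : a ≤ 1) :
    ∫ ω, X.h 0 1 (rescale η 0 (a / 2)) ω ^ 2 ∂X.P
      = 2⁻¹ ^ (2 + d) * ∫ ω, X.h 0 1 (rescale η 0 a) ω ^ 2 ∂X.P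
        + ((a / 2) ^ d * ∫ x, η x) ^ 2 * ∫ ω, X.φharm 0 2⁻¹ ω 0 ^ 2 ∂X.P := by
  have hr : (0 : ℝ) < 2⁻¹ := by norm_num
  have h1 := X.integral_H_pow hr ball_zero_half_subset (hη.isTestFun.rescale 0 ha) 1
  rw [← rescale_zero_half, mul_one, pow_one] at h1
  rw [X.integral_h_sq hr ball_zero_half_subset (hη.isTestFun.rescale 0 (half_pos ha)), h1,
    X.integral_Φ_rescale_pow hη ball_zero_half_subset (half_pos ha) (by linarith) 2]

lemma integral_h_rescale_pow_four {η : Euc d → ℝ} (hη : IsMeanValueKernel η) {a : ℝ} (ha : 0 < a)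
    (ha1 : a ≤ 1) :
    ∫ ω, X.h 0 1 (rescale η 0 (a / 2)) ω ^ 4 ∂X.P
      = (2⁻¹ ^ (2 + d)) ^ 2 * (∫ ω, X.h 0 1 (rescale η 0 a) ω ^ 4 ∂X.P)
        + 6 * ((2⁻¹ ^ (2 + d) * ∫ ω, X.h 0 1 (rescale η 0 a) ω ^ 2 ∂X.P)
          * (((a / 2) ^ d * ∫ x, η x) ^ 2 * ∫ ω, X.φharm 0 2⁻¹ ω 0 ^ 2 ∂X.P))
        + ((a / 2) ^ d * ∫ x, η x) ^ 4 * ∫ ω, X.φharm 0 2⁻¹ ω 0 ^ 4 ∂X.P := by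
  have hr : (0 : ℝ) < 2⁻¹ := by norm_num
  have h1 := X.integral_H_pow hr ball_zero_half_subset (hη.isTestFun.rescale 0 ha) 1
  have h2 := X.integral_H_pow hr ball_zero_half_subset (hη.isTestFun.rescale 0 ha) 2
  rw [← rescale_zero_half] at h1 h2
  rw [mul_one, pow_one] at h1
  rw [show 2 * 2 = 4 by norm_num] at h2
  rw [X.integral_h_pow_four hr ball_zero_half_subset (hη.isTestFun.rescale 0 (half_pos ha)), h1,
    h2, X.integral_Φ_rescale_pow hη ball_zero_half_subset (half_pos ha) (by linarith) 2,
    X.integral_Φ_rescale_pow hη ball_zero_half_subset (half_pos ha) (by linarith) 4]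

lemma exists_integral_h_rescale_pow_four_le (hd : 2 ≤ d) {η : Euc d → ℝ}
    (hη : IsMeanValueKernel η) :
    ∃ K, 0 ≤ K ∧ ∀ n : ℕ, ((2 ^ n) ^ d) ^ 4 *
      ∫ ω, X.h 0 1 (rescale η 0 (2 ^ n)⁻¹) ω ^ 4 ∂X.P ≤ K * momentGrowth d n := by
  obtain ⟨e, rfl⟩ := Nat.exists_eq_add_of_le hd
  set v := ∫ ω, X.φharm 0 2⁻¹ ω 0 ^ 2 ∂X.P with hv
  set m := ∫ ω, X.φharm 0 2⁻¹ ω 0 ^ 4 ∂X.P with hm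
  have hv0 : 0 ≤ v := by positivity
  have hm0 : 0 ≤ m := by positivity
  have hI := hη.integral_pos
  set I := ∫ x, η x with hIdef
  have hscale : ∀ n : ℕ, ((2 : ℝ) ^ (n + 1))⁻¹ = (2 ^ n)⁻¹ / 2 := fun n => by
    rw [pow_succ, mul_inv, div_eq_mul_inv]
  have hle : ∀ n : ℕ, ((2 : ℝ) ^ n)⁻¹ ≤ 1 := fun n =>
    inv_le_one_of_one_le₀ (one_le_pow₀ (by norm_num))
  refine exists_le_mul_momentGrowth hd
    (V := fun n => ((2 ^ n) ^ (2 + e)) ^ 2 * ∫ ω, X.h 0 1 (rescale η 0 (2 ^ n)⁻¹) ω ^ 2 ∂X.P)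
    (A := fun n => ((2 ^ n) ^ (2 + e)) ^ 4 * ∫ ω, X.h 0 1 (rescale η 0 (2 ^ n)⁻¹) ω ^ 4 ∂X.P)
    (c := I ^ 2 * v) (m := I ^ 4 * m) (by positivity) (by positivity) (by positivity)
    (by positivity) (fun n => ?_) (fun n => ?_)
  · rw [hscale, X.integral_h_rescale_sq hη (by positivity) (hle n), ← hv, ← hIdef]
    simp only [pow_succ (2 : ℝ) n, div_pow, inv_pow, mul_pow]
    have h2 : (2 : ℝ) ^ e ≠ 0 := by positivity
    have h3 : ((2 : ℝ) ^ n) ^ e ≠ 0 := by positivity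
    simp only [pow_add, add_tsub_cancel_left]
    field_simp
  · rw [hscale, X.integral_h_rescale_pow_four hη (by positivity) (hle n), ← hv, ← hm, ← hIdef]
    simp only [pow_succ (2 : ℝ) n, div_pow, inv_pow, mul_pow]
    have h2 : (2 : ℝ) ^ e ≠ 0 := by positivity
    have h3 : ((2 : ℝ) ^ n) ^ e ≠ 0 := by positivity
    simp only [pow_add, add_tsub_cancel_left]
    field_simp

lemma integral_h_rescale_le_zero {f : Euc d → ℝ} (hf : IsTestFun f) {z : Euc d} (hz : ‖z‖ ≤ 1)
    {a : ℝ} (ha : 0 < a) :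
    (2⁻¹ ^ (2 + d)) ^ 2 * ∫ ω, X.h 0 1 (rescale f z a) ω ^ 4 ∂X.P
      ≤ ∫ ω, X.h 0 1 (rescale f 0 (a / 2)) ω ^ 4 ∂X.P := by
  have hr : (0 : ℝ) < 2⁻¹ := by norm_num
  have hb : ball (-((2 : ℝ)⁻¹ • z)) 2⁻¹ ⊆ ball 0 1 := by
    refine ball_subset_ball' ?_
    rw [dist_zero_right, norm_neg, norm_smul, Real.norm_of_nonneg hr.le]
    linarith
  have h1 := X.integral_H_pow hr hb (hf.rescale z ha) 2
  have h2 := rescale_comp f z (-((2 : ℝ)⁻¹ • z)) a hr.ne'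
  rw [neg_add_cancel, ← div_eq_inv_mul] at h2
  rw [show 2 * 2 = 4 by norm_num] at h1
  rw [← h1, ← h2]
  refine X.integral_H_pow_four_le hr hb ?_
  exact (hf.rescale z ha).rescale _ hr

lemma exists_integral_φharm_pow_four_le (hd : 2 ≤ d) :
    ∃ C, 0 ≤ C ∧ ∀ (z : Euc d) (r : ℝ), 0 < r → ball z r ⊆ ball 0 1 →
      Integrable (fun ω => X.φharm z r ω z ^ 4) X.P ∧
      ∀ n : ℕ, (2 ^ n)⁻¹ ≤ r → ∫ ω, X.φharm z r ω z ^ 4 ∂X.P ≤ C * momentGrowth d (n + 1) := by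
  obtain ⟨η, hη⟩ := exists_isMeanValueKernel d
  obtain ⟨K, hK, hKn⟩ := X.exists_integral_h_rescale_pow_four_le hd hη
  have hI := hη.integral_pos
  set I := ∫ x, η x with hIdef
  set s : ℝ := (2⁻¹ ^ (2 + d)) ^ 2 * ((2 ^ d) ^ 4 * I ^ 4) with hs
  have hs0 : 0 < s := by positivity
  refine ⟨K / s, by positivity, fun z r hr hb => ⟨X.integrable_φharm_pow_four hη hr hb,
    fun n hn => ?_⟩⟩
  have hz : ‖z‖ ≤ 1 := (mem_ball_zero_iff.1 (hb (mem_ball_self hr))).le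
  have ha : (0 : ℝ) < (2 ^ n)⁻¹ := by positivity
  have h1 := X.integral_Φ_pow_four_le hr hb (hη.isTestFun.rescale z ha)
  rw [X.integral_Φ_rescale_pow hη hb ha hn, ← hIdef] at h1
  have h2 := X.integral_h_rescale_le_zero hη.isTestFun hz ha
  have h3 := hKn (n + 1)
  rw [show ((2 : ℝ) ^ (n + 1))⁻¹ = (2 ^ n)⁻¹ / 2 by rw [pow_succ, mul_inv, div_eq_mul_inv]] at h3
  rw [div_mul_eq_mul_div, le_div_iff₀ hs0]
  refine le_trans ?_ h3
  calc _ = ((2 ^ (n + 1)) ^ d) ^ 4 * ((2⁻¹ ^ (2 + d)) ^ 2 *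
          ((((2 : ℝ) ^ n)⁻¹ ^ d * I) ^ 4 * ∫ ω, X.φharm z r ω z ^ 4 ∂X.P)) := by
        rw [hs, pow_succ (2 : ℝ) n, mul_pow, mul_pow, mul_pow, inv_pow (2 ^ n : ℝ)]
        field_simp
    _ ≤ _ := by
        gcongr
        exact (mul_le_mul_of_nonneg_left h1 (by positivity)).trans h2

end GFF

lemma momentGrowth_le {d : ℕ} (hd : 2 ≤ d) {δ : ℝ} (hδ : 0 < δ) :
    ∃ C, 0 ≤ C ∧ ∀ (ρ r : ℝ) (n : ℕ), 0 < ρ → 0 < r → r ≤ 1 → min (ρ / 4) (δ / 2) ≤ r →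
      (2 ^ n : ℝ) ≤ 2 / r → momentGrowth d (n + 1) ≤ C * (1 + sFun d ρ ^ 2) := by
  rcases hd.eq_or_lt with rfl | hd
  · simp only [momentGrowth, sFun, if_true]
    obtain ⟨B, hB⟩ : ∃ B, B = 4 + (|Real.log 4| + |Real.log (δ / 2)| + 1) / Real.log 2 := ⟨_, rfl⟩
    have hl2 : 0 < Real.log 2 := Real.log_pos (by norm_num)
    obtain ⟨E, hE⟩ : ∃ E, E = 1 / Real.log 2 := ⟨_, rfl⟩
    have hE0 : 0 ≤ E := by rw [hE]; positivity
    have hB0 : 0 ≤ B := by rw [hB]; positivity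
    refine ⟨2 * (B + E) ^ 2, by positivity, fun ρ r n hρ hr hr1 hmin hn => ?_⟩
    have h1 : n * Real.log 2 ≤ Real.log 2 - Real.log r := by
      rw [← Real.log_pow, ← Real.log_div (by norm_num) hr.ne']
      exact Real.log_le_log (by positivity) hn
    have h2 : -Real.log r ≤ |Real.log ρ| + |Real.log 4| + |Real.log (δ / 2)| := by
      rcases min_le_iff.1 hmin with h | h
      · have := Real.log_le_log (by positivity) h
        rw [Real.log_div hρ.ne' (by norm_num)] at this
        linarith [neg_abs_le (Real.log ρ), le_abs_self (Real.log 4), abs_nonneg (Real.log (δ / 2))]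
      · have := Real.log_le_log (by positivity) h
        linarith [abs_nonneg (Real.log ρ), abs_nonneg (Real.log 4), neg_abs_le (Real.log (δ / 2))]
    have h3 : (n : ℝ) + 2 ≤ B + E * |Real.log ρ| := by
      have : (n : ℝ) ≤ (Real.log 2 - Real.log r) / Real.log 2 := (le_div_iff₀ hl2).2 h1
      have h4 : (Real.log 2 - Real.log r) / Real.log 2
          ≤ (Real.log 2 + (|Real.log ρ| + |Real.log 4| + |Real.log (δ / 2)|)) / Real.log 2 := by
        gcongr; linarith
      have h5 : (Real.log 2 + (|Real.log ρ| + |Real.log 4| + |Real.log (δ / 2)|)) / Real.log 2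
          = 1 + E * |Real.log ρ| + (|Real.log 4| + |Real.log (δ / 2)|) / Real.log 2 := by
        rw [hE]; field_simp; ring
      have h6 : (|Real.log 4| + |Real.log (δ / 2)|) / Real.log 2
          ≤ (|Real.log 4| + |Real.log (δ / 2)| + 1) / Real.log 2 :=
        div_le_div_of_nonneg_right (by linarith) hl2.le
      linarith
    have h7 : (n : ℝ) + 2 ≤ (B + E) * (1 + |Real.log ρ|) := by
      nlinarith [mul_nonneg hB0 (abs_nonneg (Real.log ρ))]
    have h8 : ((n : ℝ) + 2) ^ 2 ≤ ((B + E) * (1 + |Real.log ρ|)) ^ 2 := by gcongr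
    have h9 : (1 + |Real.log ρ|) ^ 2 ≤ 2 * (1 + Real.log ρ ^ 2) := by
      rw [← sq_abs (Real.log ρ)]
      nlinarith [sq_nonneg (1 - |Real.log ρ|)]
    push_cast
    rw [neg_sq, show (n : ℝ) + 1 + 1 = n + 2 by ring]
    calc ((n : ℝ) + 2) ^ 2 ≤ (B + E) ^ 2 * (1 + |Real.log ρ|) ^ 2 := by rw [← mul_pow]; exact h8
      _ ≤ (B + E) ^ 2 * (2 * (1 + Real.log ρ ^ 2)) := by gcongr
      _ = _ := by ring
  · have hne : d ≠ 2 := hd.ne'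
    simp only [momentGrowth, sFun, if_neg hne]
    obtain ⟨e, rfl⟩ := Nat.exists_eq_add_of_le hd.le
    rw [add_tsub_cancel_left]
    refine ⟨((16 : ℝ) ^ e) ^ 2 + ((8 / δ) ^ e) ^ 2, by positivity,
      fun ρ r n hρ hr hr1 hmin hn => ?_⟩
    have hsf : ρ ^ ((2 : ℝ) - ((2 + e : ℕ) : ℝ)) = (ρ ^ e)⁻¹ := by
      rw [show (2 : ℝ) - ((2 + e : ℕ) : ℝ) = -(e : ℝ) by push_cast; ring, Real.rpow_neg hρ.le,
        Real.rpow_natCast]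
    have hg : ((2 : ℝ) ^ e) ^ (n + 1) = (2 * 2 ^ n) ^ e := by
      rw [← pow_mul, mul_comm, pow_mul, pow_succ']
    rw [hsf, hg]
    have hS : 0 ≤ ((ρ ^ e)⁻¹) ^ 2 := by positivity
    rcases min_le_iff.1 hmin with h | h
    · have h1 : 2 * (2 : ℝ) ^ n ≤ 16 * ρ⁻¹ := by
        calc 2 * (2 : ℝ) ^ n ≤ 2 * (2 / r) := by gcongr
          _ ≤ 2 * (2 / (ρ / 4)) := by gcongr
          _ = 16 * ρ⁻¹ := by field_simp; norm_num
      calc ((2 * (2 : ℝ) ^ n) ^ e) ^ 2 ≤ ((16 * ρ⁻¹) ^ e) ^ 2 := by gcongr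
        _ = ((16 : ℝ) ^ e) ^ 2 * ((ρ ^ e)⁻¹) ^ 2 := by rw [mul_pow, mul_pow, inv_pow]
        _ ≤ _ := by
          have : 0 ≤ ((16 : ℝ) ^ e) ^ 2 := by positivity
          have : 0 ≤ ((8 / δ) ^ e) ^ 2 := by positivity
          nlinarith [mul_nonneg this hS]
    · have h1 : 2 * (2 : ℝ) ^ n ≤ 8 / δ := by
        calc 2 * (2 : ℝ) ^ n ≤ 2 * (2 / r) := by gcongr
          _ ≤ 2 * (2 / (δ / 2)) := by gcongr
          _ = 8 / δ := by field_simp; norm_num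
      calc ((2 * (2 : ℝ) ^ n) ^ e) ^ 2 ≤ ((8 / δ) ^ e) ^ 2 := by gcongr
        _ ≤ _ := by
          have h3 : 0 ≤ ((16 : ℝ) ^ e) ^ 2 := by positivity
          have h4 : 0 ≤ ((8 / δ) ^ e) ^ 2 := by positivity
          nlinarith [mul_nonneg h3 hS, mul_nonneg h4 hS]

lemma exists_k4eps_bounds {d : ℕ} {δ : ℝ} (hδ : 0 < δ) {z : Fin 4 → Euc d} (i : Fin 4)
    (hz : ‖z i‖ < 1 - δ) (hinj : Function.Injective z) :
    0 < k4eps z i ∧ k4eps z i ≤ 1 ∧ ball (z i) (k4eps z i) ⊆ ball 0 1 ∧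
      ∃ j : {j : Fin 4 // j ≠ i}, 0 < ‖z i - z j.1‖ ∧
        min (‖z i - z j.1‖ / 4) (δ / 2) ≤ k4eps z i := by
  have : Nonempty {j : Fin 4 // j ≠ i} := ⟨⟨i + 1, by fin_cases i <;> decide⟩⟩
  obtain ⟨j, hj⟩ := exists_eq_ciInf_of_finite (f := fun j : {j : Fin 4 // j ≠ i} =>
    dist (z i) (z j.1))
  have hpos : 0 < ‖z i - z j.1‖ := norm_pos_iff.2 (sub_ne_zero.2 fun h => j.2 (hinj h).symm)
  have hk : k4eps z i = min (‖z i - z j.1‖ / 2) (1 - ‖z i‖) / 2 := by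
    rw [k4eps, ← hj, dist_eq_norm]
  have hle : k4eps z i ≤ (1 - ‖z i‖) / 2 := by
    rw [hk]
    gcongr
    exact min_le_right _ _
  have hn := norm_nonneg (z i)
  refine ⟨?_, by linarith, ?_, j, hpos, ?_⟩
  · rw [hk]
    have : 0 < min (‖z i - z j.1‖ / 2) (1 - ‖z i‖) := lt_min (by positivity) (by linarith)
    positivity
  · refine ball_subset_ball' ?_
    rw [dist_zero_right]
    linarith
  · rw [hk, le_div_iff₀ (by norm_num)]
    refine le_min ?_ ?_
    · have := min_le_left (‖z i - z j.1‖ / 4) (δ / 2)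
      linarith
    · have := min_le_right (‖z i - z j.1‖ / 4) (δ / 2)
      linarith

/-- the crude upper bound for the four-point function. -/
theorem statement6 (d : ℕ) (hd : 2 ≤ d) (Ω : Type) [MeasurableSpace Ω] (X : GFF d Ω) (δ : ℝ) (hδ : 0 < δ) :
    ∃ C : ℝ, ∀ z : Fin 4 → Euc d, (∀ i, ‖z i‖ < 1 - δ) → Function.Injective z →
      |X.k4 z| ^ 4
        ≤ C * ∏ i, (1 + ⨆ j : {j : Fin 4 // j ≠ i}, (sFun d ‖z i - z j.1‖) ^ 2) := by
  obtain ⟨C₁, hC₁, hφ⟩ := X.exists_integral_φharm_pow_four_le hd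
  obtain ⟨C₂, hC₂, hgrowth⟩ := momentGrowth_le hd hδ
  refine ⟨∏ _i : Fin 4, C₁ * C₂, fun z hz hinj => ?_⟩
  have hmom : ∀ i, Integrable (fun ω => X.φharm (z i) (k4eps z i) ω (z i) ^ 4) X.P ∧
      ∫ ω, X.φharm (z i) (k4eps z i) ω (z i) ^ 4 ∂X.P ≤
        C₁ * C₂ * (1 + ⨆ j : {j : Fin 4 // j ≠ i}, (sFun d ‖z i - z j.1‖) ^ 2) := by
    intro i
    obtain ⟨hr, hr1, hb, j, hj, hmin⟩ := exists_k4eps_bounds hδ i (hz i) hinj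
    obtain ⟨hint, hle⟩ := hφ (z i) (k4eps z i) hr hb
    refine ⟨hint, ?_⟩
    obtain ⟨n, hn, hn'⟩ := exists_nat_pow_near ((one_le_inv₀ hr).2 hr1) (one_lt_two (α := ℝ))
    have h2 : (2 : ℝ) ^ (n + 1) ≤ 2 / k4eps z i := by
      rw [pow_succ, div_eq_mul_inv]
      linarith
    refine (hle (n + 1) (inv_le_of_inv_le₀ hr hn'.le)).trans ?_
    rw [mul_assoc]
    refine mul_le_mul_of_nonneg_left ((hgrowth _ _ _ hj hr hr1 hmin h2).trans ?_) hC₁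
    gcongr
    exact le_ciSup (f := fun j : {j : Fin 4 // j ≠ i} => (sFun d ‖z i - z j.1‖) ^ 2)
      (Set.finite_range _).bddAbove j
  refine (abs_integral_prod_pow_four_le (fun i => X.meas_φharm _ _ _) fun i => (hmom i).1).trans ?_
  rw [← Finset.prod_mul_distrib]
  exact Finset.prod_le_prod (fun i _ => by positivity) fun i _ => (hmom i).2
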